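/- Let n ≥ 1, m ≥ 1, and k ≥ 0, and let D^m(A_n)_k denote the real vector space of m-multiderivations of the braid arrangement A_n in ℝ^{n+1} that are homogeneous of degree k. Then dim_ℝ D^m(A_n)_k = binom(k+n, n) + n · binom(k + n − m(n+1)/2, n) if m is even, and dim_ℝ D^m(A_n)_k = binom(k+n, n) + Σ_{i=1}^{n} binom(k + n − (m−1)(n+1)/2 − i, n) if m is odd, with the convention that binom(a, n) = 0 whenever a < n. -/

import Mathlib

open MvPolynomial

noncomputable section

/-- The real vector space `D^m(A_n)_k` of `m`-multiderivations of the braid arrangement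
`A_n = ⋃_{i<j} V(x_j - x_i) ⊆ ℝ^{n+1}` that are homogeneous of degree `k`: identifying a
derivation `θ = Σ f_l ∂/∂x_l` of `S = ℝ[x_1, …, x_{n+1}]` with the tuple `(f_1, …, f_{n+1})`,
it consists of those tuples with `(x_j - x_i)^m ∣ f_j - f_i` for all `i < j` and with every
`f_l` homogeneous of degree `k`. -/
def multiDerDeg (n m k : ℕ) : Submodule ℝ (Fin (n + 1) → MvPolynomial (Fin (n + 1)) ℝ) where
  carrier := { f | (∀ i j : Fin (n + 1), i < j → (X j - X i) ^ m ∣ f j - f i) ∧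
      ∀ l : Fin (n + 1), (f l).IsHomogeneous k }
  add_mem' := by
    rintro f g ⟨hf, hf'⟩ ⟨hg, hg'⟩
    refine ⟨fun i j hij => ?_, fun l => ?_⟩
    · simpa [add_sub_add_comm] using dvd_add (hf i j hij) (hg i j hij)
    · exact (hf' l).add (hg' l)
  zero_mem' := ⟨by intro i j hij; simp, fun l => by simpa using isHomogeneous_zero _ ℝ k⟩
  smul_mem' := by
    rintro c f ⟨hf, hf'⟩
    refine ⟨fun i j hij => ?_, fun l => ?_⟩
    · have := (hf i j hij).mul_left (C c)
      simpa [Pi.smul_apply, MvPolynomial.smul_eq_C_mul, mul_sub] using this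
    · have := (isHomogeneous_C (Fin (n + 1)) c).mul (hf' l)
      simpa [Pi.smul_apply, MvPolynomial.smul_eq_C_mul] using this

theorem C_pow_dvd_eval_sub_eval {R : Type*} [CommRing R] [Algebra ℝ R] {F : Polynomial R} {d : R}
    (h : Polynomial.C d ∣ Polynomial.derivative F) (x y : R) : 
    d ∣ F.eval x - F.eval y := by
  have key : ∀ e, d ∣ F.coeff (e + 1) := fun e => by
    have h1 := (Polynomial.C_dvd_iff_dvd_coeff _ _).1 h e
    rw [Polynomial.coeff_derivative] at h1
    have h2 := h1.mul_right (algebraMap ℝ R ((e + 1 : ℝ)⁻¹))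
    rwa [mul_assoc, ← Nat.cast_add_one, ← map_natCast (algebraMap ℝ R), ← map_mul, Nat.cast_add_one,
      mul_inv_cancel₀ (by positivity), map_one, mul_one] at h2
  rw [Polynomial.eval_eq_sum_range, Polynomial.eval_eq_sum_range, ← Finset.sum_sub_distrib]
  refine Finset.dvd_sum fun e _ => ?_
  rw [← mul_sub]
  cases e with
  | zero => simp
  | succ e => exact (key e).mul_right _

theorem pow_dvd_eval_sub_eval {R : Type*} [CommRing R] [Algebra ℝ R] {F : Polynomial R} {a b : R}
    {u v : ℕ} (h : (Polynomial.X - Polynomial.C a) ^ u * (Polynomial.X - Polynomial.C b) ^ v ∣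
      Polynomial.derivative F) :
    (b - a) ^ (u + v + 1) ∣ F.eval b - F.eval a := by
  let L : Polynomial R := Polynomial.C a + Polynomial.C (b - a) * Polynomial.X
  have hL : Polynomial.C ((b - a) ^ (u + v + 1)) ∣ Polynomial.derivative (F.comp L) := by
    obtain ⟨H, hH⟩ := h
    refine ⟨Polynomial.X ^ u * (Polynomial.X - 1) ^ v * H.comp L, ?_⟩
    have hL' : Polynomial.derivative L = Polynomial.C (b - a) := by simp [L]
    rw [Polynomial.derivative_comp, hH, hL']
    simp only [Polynomial.mul_comp, Polynomial.pow_comp, Polynomial.sub_comp, Polynomial.X_comp,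
      Polynomial.C_comp]
    have e1 : L - Polynomial.C a = Polynomial.C (b - a) * Polynomial.X := by simp [L]
    have e2 : L - Polynomial.C b = Polynomial.C (b - a) * (Polynomial.X - 1) := by
      simp only [L, map_sub]; ring
    rw [e1, e2, map_pow, mul_pow, mul_pow]
    ring
  simpa [L] using C_pow_dvd_eval_sub_eval hL 1 0

theorem exists_derivative_eq {N d : ℕ} {A : MvPolynomial (Fin (N + 1)) ℝ}
    (hA : A.IsHomogeneous d) :
    ∃ F : Polynomial (MvPolynomial (Fin N) ℝ), Polynomial.derivative F = finSuccEquiv ℝ N A ∧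
      ∀ i, (F.eval (X i)).IsHomogeneous (d + 1) := by
  let P := finSuccEquiv ℝ N A
  refine ⟨∑ e ∈ Finset.range (d + 1),
    Polynomial.monomial (e + 1) (C ((e + 1 : ℝ)⁻¹) * P.coeff e), ?_, fun i => ?_⟩
  · have hd : P.natDegree < d + 1 := by
      rw [natDegree_finSuccEquiv]
      exact Nat.lt_succ_of_le ((degreeOf_le_totalDegree A 0).trans hA.totalDegree_le)
    change _ = P
    conv_rhs => rw [P.as_sum_range' _ hd]
    rw [Polynomial.derivative_sum]
    refine Finset.sum_congr rfl fun e _ => ?_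
    rw [Polynomial.derivative_monomial, Nat.add_sub_cancel]
    congr 1
    rw [mul_right_comm, ← map_natCast (C : ℝ →+* MvPolynomial (Fin N) ℝ), ← map_mul,
      Nat.cast_add_one, inv_mul_cancel₀ (by positivity), map_one, one_mul]
  · rw [Polynomial.eval_finsetSum]
    refine IsHomogeneous.sum _ _ _ fun e he => ?_
    have he' : e ≤ d := Nat.lt_succ_iff.1 (Finset.mem_range.1 he)
    rw [Polynomial.eval_monomial]
    have h1 := ((hA.finSuccEquiv_coeff_isHomogeneous e (d - e) (by omega)).C_mul
      ((e + 1 : ℝ)⁻¹)).mul (isHomogeneous_X_pow (R := ℝ) i (e + 1))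
    rwa [show d - e + (e + 1) = d + 1 by omega] at h1

theorem prime_X_sub_X {σ : Type*} {i j : σ} (h : i ≠ j) :
    Prime (X j - X i : MvPolynomial σ ℝ) := by
  classical
  have : Irreducible (1 * X j + (- X i) : MvPolynomial σ ℝ) :=
    irreducible_mul_X_add 1 (-X i) j one_ne_zero (by simp) (by simp [vars_neg, vars_X, h.symm])
      isRelPrime_one_left
  have h2 := this.prime
  rwa [one_mul, ← sub_eq_add_neg] at h2

theorem isRelPrime_X_sub_X {σ : Type*} {i j k l : σ} (hij : i ≠ j) (hkl : k ≠ l)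
    (h : ¬ (k ∈ ({i, j} : Set σ) ∧ l ∈ ({i, j} : Set σ))) :
    IsRelPrime (X j - X i : MvPolynomial σ ℝ) (X l - X k) := by
  classical
  rw [(prime_X_sub_X hij).irreducible.isRelPrime_iff_not_dvd]
  intro hdvd
  have key : ∀ x : σ → ℝ, x i = x j → x k = x l := fun x hx => by
    have := map_dvd (eval x) hdvd
    simp only [map_sub, eval_X, hx, sub_self, zero_dvd_iff] at this
    linarith
  rw [not_and_or] at h
  simp only [Set.mem_insert_iff, Set.mem_singleton_iff, not_or] at h
  rcases h with h | h
  · have := key (Pi.single k 1) (by simp [Ne.symm h.1, Ne.symm h.2])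
    simp [hkl.symm] at this
  · have := key (Pi.single l 1) (by simp [Ne.symm h.1, Ne.symm h.2])
    simp [hkl] at this

/-- The index set of the braid arrangement: the pairs `⟨j, i⟩` with `i < j`. -/
def braidPairs (n : ℕ) : Finset (Σ _ : Fin (n + 1), Fin (n + 1)) :=
  Finset.univ.sigma fun j => Finset.Iio j

theorem mem_braidPairs {n : ℕ} {q : Σ _ : Fin (n + 1), Fin (n + 1)} :
    q ∈ braidPairs n ↔ q.2 < q.1 := by
  simp [braidPairs]

theorem card_braidPairs_mul_two (n : ℕ) : (braidPairs n).card * 2 = (n + 1) * n := by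
  rw [braidPairs, Finset.card_sigma]
  simp only [Fin.card_Iio]
  rw [Fin.sum_univ_eq_sum_range (fun i => i), Finset.sum_range_id_mul_two, Nat.add_sub_cancel]

/-- The `m`-th power of the defining polynomial of the braid arrangement. -/
def braidPoly (n m : ℕ) : MvPolynomial (Fin (n + 1)) ℝ :=
  ∏ q ∈ braidPairs n, (X q.1 - X q.2) ^ m

theorem braidPoly_dvd {n m : ℕ} {p : MvPolynomial (Fin (n + 1)) ℝ}
    (h : ∀ i j : Fin (n + 1), i < j → (X j - X i) ^ m ∣ p) :
    braidPoly n m ∣ p := by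
  refine Finset.prod_dvd_of_isRelPrime (fun q hq r hr hqr => ?_) fun q hq => ?_
  · have hq' : q.2 < q.1 := mem_braidPairs.1 hq
    have hr' : r.2 < r.1 := mem_braidPairs.1 hr
    refine (isRelPrime_X_sub_X hq'.ne hr'.ne ?_).pow
    simp only [Set.mem_insert_iff, Set.mem_singleton_iff]
    rintro ⟨h1, h2⟩
    apply hqr
    obtain ⟨q1, q2⟩ := q
    obtain ⟨r1, r2⟩ := r
    grind
  · exact h _ _ (mem_braidPairs.1 hq)

theorem braidPoly_ne_zero (n m : ℕ) : braidPoly n m ≠ 0 :=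
  Finset.prod_ne_zero_iff.2 fun _ hq =>
    pow_ne_zero _ (prime_X_sub_X (mem_braidPairs.1 hq).ne).ne_zero

theorem isHomogeneous_braidPoly (n m : ℕ) :
    (braidPoly n m).IsHomogeneous ((braidPairs n).card * m) := by
  have h := IsHomogeneous.prod (braidPairs n) (fun q => (X q.1 - X q.2 : MvPolynomial _ ℝ) ^ m)
    (fun _ => m) fun q _ => by
      simpa using ((isHomogeneous_X ℝ q.1).sub (isHomogeneous_X ℝ q.2)).pow m
  rwa [Finset.sum_const, smul_eq_mul] at h

theorem finrank_homogeneousSubmodule (n k : ℕ) :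
    Module.finrank ℝ (homogeneousSubmodule (Fin (n + 1)) ℝ k) = (k + n).choose n := by
  have e : homogeneousSubmodule (Fin (n + 1)) ℝ k =
      restrictSupport ℝ ((Finset.finsuppAntidiag Finset.univ k : Finset (Fin (n + 1) →₀ ℕ)) :
        Set (Fin (n + 1) →₀ ℕ)) := by
    rw [homogeneousSubmodule_eq_finsupp_supported, restrictSupport]
    congr 1
    ext d
    simp [Finsupp.degree_eq_sum]
  rw [e, Module.finrank_eq_card_basis (basisRestrictSupport ℝ _)]
  simp only [Finset.coe_sort_coe, Fintype.card_coe, Finset.card_finsuppAntidiag_nat_eq_choose,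
    Finset.card_univ, Fintype.card_fin]
  rw [show n + 1 + k - 1 = k + n by omega, Nat.choose_symm_add]

/-- The homogeneous polynomials `p` such that `p * q` has degree `k` for `q` of degree `d`. -/
def homogeneousShift (n k d : ℕ) : Submodule ℝ (MvPolynomial (Fin (n + 1)) ℝ) :=
  if d ≤ k then homogeneousSubmodule (Fin (n + 1)) ℝ (k - d) else ⊥

theorem homogeneousShift_of_le {n k d : ℕ} (h : d ≤ k) :
    homogeneousShift n k d = homogeneousSubmodule (Fin (n + 1)) ℝ (k - d) :=
  if_pos h

theorem homogeneousShift_of_not_le {n k d : ℕ} (h : ¬ d ≤ k) : homogeneousShift n k d = ⊥ :=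
  if_neg h

instance (n k d : ℕ) : Module.Finite ℝ (homogeneousShift n k d) := by
  by_cases h : d ≤ k
  · rw [homogeneousShift_of_le h]
    exact Module.Finite.iff_fg.2 (homogeneousSubmodule_fg _ _ _)
  · rw [homogeneousShift_of_not_le h]
    infer_instance

theorem finrank_homogeneousShift {n : ℕ} (hn : 1 ≤ n) (k d : ℕ) :
    Module.finrank ℝ (homogeneousShift n k d) = (k + n - d).choose n := by
  by_cases h : d ≤ k
  · rw [homogeneousShift_of_le h, finrank_homogeneousSubmodule,
      show k + n - d = k - d + n by omega]
  · rw [homogeneousShift_of_not_le h, finrank_bot, Nat.choose_eq_zero_of_lt (by omega)]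

theorem isHomogeneous_mul_of_mem_homogeneousShift {n k d : ℕ} {p q : MvPolynomial (Fin (n + 1)) ℝ}
    (hp : p ∈ homogeneousShift n k d) (hq : q.IsHomogeneous d) : (p * q).IsHomogeneous k := by
  by_cases h : d ≤ k
  · rw [homogeneousShift_of_le h, mem_homogeneousSubmodule] at hp
    have := hp.mul hq
    rwa [Nat.sub_add_cancel h] at this
  · rw [homogeneousShift_of_not_le h, Submodule.mem_bot] at hp
    rw [hp, zero_mul]
    exact isHomogeneous_zero _ _ _

theorem exists_homogeneousComponent_mul {n : ℕ} (k d : ℕ) (p : MvPolynomial (Fin (n + 1)) ℝ) :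
    ∃ p' ∈ homogeneousShift n k d, ∀ q : MvPolynomial (Fin (n + 1)) ℝ, q.IsHomogeneous d →
      homogeneousComponent k (p * q) = p' * q := by
  let := gradedAlgebra (σ := Fin (n + 1)) (R := ℝ)
  have hc : ∀ (k : ℕ) (p : MvPolynomial (Fin (n + 1)) ℝ), homogeneousComponent k p =
      (DirectSum.decompose (homogeneousSubmodule (Fin (n + 1)) ℝ) p k : MvPolynomial _ ℝ) :=
    fun k p => (decomposition.decompose'_apply p k).symm
  by_cases h : d ≤ k
  · rw [homogeneousShift_of_le h]
    refine ⟨homogeneousComponent (k - d) p, homogeneousComponent_mem _ _, fun q hq => ?_⟩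
    rw [hc, hc]
    exact DirectSum.coe_decompose_mul_of_right_mem_of_le _ hq h
  · refine ⟨0, Submodule.zero_mem _, fun q hq => ?_⟩
    rw [hc, zero_mul]
    exact DirectSum.coe_decompose_mul_of_right_mem_of_not_le _ hq h

theorem pow_dvd_det {n m : ℕ}
    {M : Matrix (Fin (n + 1)) (Fin (n + 1)) (MvPolynomial (Fin (n + 1)) ℝ)}
    {i j : Fin (n + 1)} (hij : i ≠ j) (h : ∀ r, (X j - X i) ^ m ∣ M r j - M r i) :
    (X j - X i) ^ m ∣ M.det := by
  choose c hc using h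
  rw [← Matrix.det_updateCol_add_smul_self M hij.symm (-1),
    show (fun r => M r j + (-1 : MvPolynomial (Fin (n + 1)) ℝ) • M r i) =
      ((X j - X i : MvPolynomial (Fin (n + 1)) ℝ) ^ m) • c from funext fun r => by
        simp only [Pi.smul_apply, smul_eq_mul, ← hc]; ring, Matrix.det_updateCol_smul]
  exact dvd_mul_right _ _

theorem totalDegree_det_le {n : ℕ}
    {M : Matrix (Fin (n + 1)) (Fin (n + 1)) (MvPolynomial (Fin (n + 1)) ℝ)} {d : Fin (n + 1) → ℕ}
    (h : ∀ r i, (M r i).IsHomogeneous (d r)) : M.det.totalDegree ≤ ∑ r, d r := by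
  refine IsHomogeneous.totalDegree_le ?_
  rw [← Matrix.det_transpose, Matrix.det_apply]
  refine IsHomogeneous.sum _ _ _ fun s _ => ?_
  rw [Units.smul_def, zsmul_eq_mul, ← map_intCast (C : ℝ →+* MvPolynomial (Fin (n + 1)) ℝ)]
  exact (IsHomogeneous.prod _ _ _ fun r _ => h r _).C_mul _

/-- Saito's criterion together with the resulting Hilbert function. -/
theorem finrank_multiDerDeg_of_det_ne_zero {n m : ℕ} (hn : 1 ≤ n) (k : ℕ) (d : Fin (n + 1) → ℕ)
    (M : Matrix (Fin (n + 1)) (Fin (n + 1)) (MvPolynomial (Fin (n + 1)) ℝ))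
    (hM : ∀ r, M r ∈ multiDerDeg n m (d r)) (hdet : M.det ≠ 0)
    (hd : (∑ r, d r) * 2 = (n + 1) * n * m) :
    Module.finrank ℝ (multiDerDeg n m k) = ∑ r, (k + n - d r).choose n := by
  obtain ⟨c, hc⟩ : ∃ c : ℝ, M.det = braidPoly n m * C c := by
    obtain ⟨b, hb⟩ : braidPoly n m ∣ M.det :=
      braidPoly_dvd fun i j hij => pow_dvd_det hij.ne fun r => (hM r).1 i j hij
    have hb0 : b ≠ 0 := by rintro rfl; exact hdet (by simp [hb])
    have h1 := totalDegree_det_le fun r i => (hM r).2 i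
    rw [hb, totalDegree_mul_of_isDomain (braidPoly_ne_zero n m) hb0,
      (isHomogeneous_braidPoly n m).totalDegree (braidPoly_ne_zero n m)] at h1
    have h2 := card_braidPairs_mul_two n
    have h3 : b.totalDegree = 0 := by
      rw [← h2] at hd
      nlinarith
    exact ⟨_, by rw [hb, ← (totalDegree_eq_zero_iff_eq_C.1 h3)]⟩
  have hc0 : c ≠ 0 := by rintro rfl; exact hdet (by simp [hc])
  let L : (∀ r, homogeneousShift n k (d r)) →ₗ[ℝ] Fin (n + 1) → MvPolynomial (Fin (n + 1)) ℝ :=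
    (Matrix.mulVecLin M.transpose).restrictScalars ℝ ∘ₗ
      LinearMap.pi fun r => (homogeneousShift n k (d r)).subtype ∘ₗ LinearMap.proj r
  have hL : ∀ a i, L a i = ∑ r, (a r : MvPolynomial (Fin (n + 1)) ℝ) * M r i := fun a i => by
    simp [L, Matrix.vecMul, dotProduct]
  have hinj : Function.Injective L := by
    refine fun a b hab => funext fun r => Subtype.ext ?_
    have := Matrix.mulVec_injective_of_det_ne_zero (M := M.transpose) (by rwa [Matrix.det_transpose])
    exact congrFun (this hab) r
  have hrange : LinearMap.range L = multiDerDeg n m k := by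
    ext f
    constructor
    · rintro ⟨a, rfl⟩
      refine ⟨fun i j hij => ?_, fun i => ?_⟩
      · rw [hL, hL, ← Finset.sum_sub_distrib]
        refine Finset.dvd_sum fun r _ => ?_
        rw [← mul_sub]
        exact ((hM r).1 i j hij).mul_left _
      · rw [hL]
        exact IsHomogeneous.sum _ _ _ fun r _ =>
          isHomogeneous_mul_of_mem_homogeneousShift (a r).2 ((hM r).2 i)
    · intro hf
      have hcr : ∀ r, M.det ∣ M.transpose.cramer f r := fun r => by
        rw [Matrix.cramer_transpose_apply, hc]
        refine (((isUnit_iff_ne_zero.2 hc0).map C).mul_right_dvd).2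
          (braidPoly_dvd fun i j hij => pow_dvd_det hij.ne fun s => ?_)
        by_cases hs : s = r
        · subst hs
          simpa using hf.1 i j hij
        · simpa [Matrix.updateRow_ne hs] using (hM s).1 i j hij
      choose a ha using hcr
      have hfa : ∀ i, f i = ∑ r, a r * M r i := fun i => by
        have h1 := congrFun (Matrix.mulVec_cramer M.transpose f) i
        rw [Matrix.det_transpose] at h1
        refine mul_left_cancel₀ hdet ?_
        rw [← smul_eq_mul, ← Pi.smul_apply, ← h1, Finset.mul_sum]
        simp only [Matrix.mulVec, dotProduct, Matrix.transpose_apply, ha]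
        exact Finset.sum_congr rfl fun r _ => by ring
      choose b hb hb' using fun r => exists_homogeneousComponent_mul k (d r) (a r)
      refine ⟨fun r => ⟨b r, hb r⟩, funext fun i => ?_⟩
      rw [hL, ← homogeneousComponent_eq_self (hf.2 i), hfa i, map_sum]
      exact Finset.sum_congr rfl fun r _ => (hb' r _ ((hM r).2 i)).symm
  rw [← hrange, LinearMap.finrank_range_of_inj hinj, Module.finrank_pi_fintype]
  exact Finset.sum_congr rfl fun r _ => finrank_homogeneousShift hn k (d r)

/-- The generic polynomial `∏ (t - x_j)` in a new variable `t`. -/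
def nodePoly (n : ℕ) : Polynomial (MvPolynomial (Fin (n + 1)) ℝ) :=
  ∏ j : Fin (n + 1), (Polynomial.X - Polynomial.C (X j))

theorem X_sub_C_mul_X_sub_C_pow_dvd_nodePoly_pow {n : ℕ} {i j : Fin (n + 1)} (h : i ≠ j) (p : ℕ) :
    (Polynomial.X - Polynomial.C (X i)) ^ p * (Polynomial.X - Polynomial.C (X j)) ^ p ∣
      nodePoly n ^ p := by
  rw [← mul_pow, ← Finset.prod_pair
    (f := fun j : Fin (n + 1) => (Polynomial.X - Polynomial.C (X j : MvPolynomial _ ℝ))) h]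
  exact pow_dvd_pow_of_dvd (Finset.prod_dvd_prod_of_subset _ _ _ (Finset.subset_univ _)) _

/-- Specialization of `x_0, …, x_n` to `0, …, n`. -/
def evalNodes (n : ℕ) : MvPolynomial (Fin (n + 1)) ℝ →+* ℝ :=
  eval fun i : Fin (n + 1) => (i : ℝ)

@[simp]
theorem evalNodes_X {n : ℕ} (i : Fin (n + 1)) : evalNodes n (X i) = i := by
  simp [evalNodes]

theorem eval_map_nodePoly_ne_zero {n : ℕ} {i : ℕ} {y : ℝ} (hy : y ∈ Set.Ioo (i : ℝ) (i + 1)) :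
    ((nodePoly n).map (evalNodes n)).eval y ≠ 0 := by
  rw [nodePoly, Polynomial.map_prod, Polynomial.eval_prod]
  refine Finset.prod_ne_zero_iff.2 fun j _ => ?_
  simp only [Polynomial.map_sub, Polynomial.map_X, Polynomial.map_C, evalNodes_X,
    Polynomial.eval_sub, Polynomial.eval_X, Polynomial.eval_C]
  intro h
  have h1 : (i : ℝ) < (j : ℕ) := by linarith [hy.1]
  have h2 : ((j : ℕ) : ℝ) < (i + 1 : ℕ) := by push_cast; linarith [hy.2]
  have h3 := Nat.cast_lt.1 h1
  have h4 := Nat.cast_lt.1 h2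
  omega

theorem det_ne_zero_of_derivative_eq {n q : ℕ}
    {F g : Fin n → Polynomial (MvPolynomial (Fin (n + 1)) ℝ)}
    (hF : ∀ r, Polynomial.derivative (F r) = nodePoly n ^ q * g r)
    (hg : ∀ (c : Fin n → ℝ) (y : Fin n → ℝ), (∀ i : Fin n, y i ∈ Set.Ioo (i : ℝ) (i + 1)) →
      (∀ i, (∑ r, Polynomial.C (c r) * (g r).map (evalNodes n)).eval (y i) = 0) → c = 0) :
    (Matrix.of (Fin.cons (fun _ => 1) fun r i => (F r).eval (X i)) :
      Matrix (Fin (n + 1)) (Fin (n + 1)) (MvPolynomial (Fin (n + 1)) ℝ)).det ≠ 0 := by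
  set M : Matrix (Fin (n + 1)) (Fin (n + 1)) (MvPolynomial (Fin (n + 1)) ℝ) :=
    Matrix.of (Fin.cons (fun _ => 1) fun r i => (F r).eval (X i)) with hM
  intro h
  have hev : ((evalNodes n).mapMatrix M).det = 0 := by rw [← RingHom.map_det, h, map_zero]
  obtain ⟨v, hv0, hv⟩ := Matrix.exists_vecMul_eq_zero_iff.2 hev
  set Φ : Polynomial ℝ := Polynomial.C (v 0) +
    ∑ r : Fin n, Polynomial.C (v r.succ) * (F r).map (evalNodes n) with hΦ
  have hΦ0 : ∀ i : Fin (n + 1), Φ.eval (i : ℝ) = 0 := fun i => by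
    have h1 := congrFun hv i
    simp only [Matrix.vecMul, dotProduct, Fin.sum_univ_succ, RingHom.mapMatrix_apply,
      Matrix.map_apply, hM, Matrix.of_apply, Fin.cons_zero, Fin.cons_succ, map_one, mul_one,
      Pi.zero_apply] at h1
    rw [hΦ, ← h1]
    simp only [Polynomial.eval_add, Polynomial.eval_C, Polynomial.eval_finsetSum,
      Polynomial.eval_mul]
    congr 1
    refine Finset.sum_congr rfl fun r _ => ?_
    rw [← evalNodes_X i, Polynomial.eval_map_apply]
  have hΦ' : Polynomial.derivative Φ = (nodePoly n).map (evalNodes n) ^ q *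
      ∑ r, Polynomial.C (v r.succ) * (g r).map (evalNodes n) := by
    rw [hΦ, Polynomial.derivative_add, Polynomial.derivative_C, zero_add,
      Polynomial.derivative_sum, Finset.mul_sum]
    refine Finset.sum_congr rfl fun r _ => ?_
    rw [Polynomial.derivative_C_mul, Polynomial.derivative_map, hF, Polynomial.map_mul,
      Polynomial.map_pow]
    ring
  have hroot : ∀ i : Fin n, ∃ y ∈ Set.Ioo (i : ℝ) (i + 1),
      (∑ r, Polynomial.C (v r.succ) * (g r).map (evalNodes n)).eval y = 0 := fun i => by
    obtain ⟨y, hy, hy'⟩ := exists_deriv_eq_zero (f := fun t => Φ.eval t) (lt_add_one (i : ℝ))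
      Φ.continuous.continuousOn (by
        have h1 := hΦ0 i.castSucc
        have h2 := hΦ0 i.succ
        simp only [Fin.val_castSucc, Fin.val_succ, Nat.cast_add, Nat.cast_one] at h1 h2
        rw [h1, h2])
    refine ⟨y, hy, ?_⟩
    rw [Polynomial.deriv, hΦ', Polynomial.eval_mul, Polynomial.eval_pow] at hy'
    exact (mul_eq_zero.1 hy').resolve_left (pow_ne_zero _ (eval_map_nodePoly_ne_zero hy))
  choose y hy hy' using hroot
  have hvs := hg _ y hy hy'
  apply hv0
  funext r
  refine Fin.cases ?_ (fun r => congrFun hvs r) r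
  have h0 := hΦ0 0
  rw [hΦ] at h0
  simpa [show ∀ r : Fin n, v r.succ = 0 from fun r => congrFun hvs r] using h0

theorem const_mem_multiDerDeg (n m : ℕ) : (fun _ => 1) ∈ multiDerDeg n m 0 :=
  ⟨fun i j _ => by simp, fun _ => isHomogeneous_one _ _⟩

/-- Integral expressions `f_i = ∫^{x_i} ∏ (t - x_j)^q g_r(t) dt` give a basis of `D^m(A_n)`. -/
theorem finrank_multiDerDeg_of_integrands {n m q : ℕ} (hn : 1 ≤ n) (k : ℕ)
    (A : Fin n → MvPolynomial (Fin (n + 2)) ℝ) (d : Fin n → ℕ)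
    (g : Fin n → Polynomial (MvPolynomial (Fin (n + 1)) ℝ)) (hA : ∀ r, (A r).IsHomogeneous (d r))
    (hAg : ∀ r, finSuccEquiv ℝ (n + 1) (A r) = nodePoly n ^ q * g r)
    (hdvd : ∀ r i j, i ≠ j → ∃ u v, u + v + 1 = m ∧
      (Polynomial.X - Polynomial.C (X i)) ^ u * (Polynomial.X - Polynomial.C (X j)) ^ v ∣
        nodePoly n ^ q * g r)
    (hg : ∀ (c : Fin n → ℝ) (y : Fin n → ℝ), (∀ i : Fin n, y i ∈ Set.Ioo (i : ℝ) (i + 1)) →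
      (∀ i, (∑ r, Polynomial.C (c r) * (g r).map (evalNodes n)).eval (y i) = 0) → c = 0)
    (hd : (∑ r, (d r + 1)) * 2 = (n + 1) * n * m) :
    Module.finrank ℝ (multiDerDeg n m k) =
      (k + n).choose n + ∑ r, (k + n - (d r + 1)).choose n := by
  choose F hF hFh using fun r => exists_derivative_eq (hA r)
  rw [finrank_multiDerDeg_of_det_ne_zero hn k (Fin.cons 0 fun r => d r + 1) _ ?_
    (det_ne_zero_of_derivative_eq (fun r => (hF r).trans (hAg r)) hg) ?_]
  · simp [Fin.sum_univ_succ]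
  · refine Fin.cases (const_mem_multiDerDeg n m) fun r => ⟨fun i j hij => ?_, fun i => hFh r i⟩
    obtain ⟨u, v, rfl, h⟩ := hdvd r i j hij.ne
    exact pow_dvd_eval_sub_eval (((hF r).trans (hAg r)).symm ▸ h)
  · simpa [Fin.sum_univ_succ] using hd

theorem isHomogeneous_X_sub_X {σ : Type*} (i j : σ) :
    (X i - X j : MvPolynomial σ ℝ).IsHomogeneous 1 :=
  (isHomogeneous_X ℝ i).sub (isHomogeneous_X ℝ j)

theorem isHomogeneous_prod_X_sub_X (n : ℕ) (s : Finset (Fin (n + 1))) :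
    (∏ j ∈ s, (X 0 - X j.succ : MvPolynomial (Fin (n + 2)) ℝ)).IsHomogeneous s.card := by
  simpa only [Finset.card_eq_sum_ones] using
    IsHomogeneous.prod s _ _ fun j _ => isHomogeneous_X_sub_X 0 j.succ

theorem finSuccEquiv_prod_X_sub_X (n : ℕ) (s : Finset (Fin (n + 1))) :
    finSuccEquiv ℝ (n + 1) (∏ j ∈ s, (X 0 - X j.succ)) =
      ∏ j ∈ s, (Polynomial.X - Polynomial.C (X j)) := by
  rw [map_prod]
  exact Finset.prod_congr rfl fun j _ => by
    rw [map_sub, finSuccEquiv_X_zero, finSuccEquiv_X_succ]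

theorem strictMono_of_mem_Ioo {n : ℕ} {y : Fin n → ℝ}
    (hy : ∀ i : Fin n, y i ∈ Set.Ioo (i : ℝ) (i + 1)) :
    StrictMono y := fun i j hij => by
  have h : ((i + 1 : ℕ) : ℝ) ≤ (j : ℕ) := Nat.cast_le.2 (Nat.succ_le_of_lt hij)
  push_cast at h
  linarith [(hy i).2, (hy j).1]

theorem finrank_multiDerDeg_odd {n : ℕ} (hn : 1 ≤ n) (p k : ℕ) :
    Module.finrank ℝ (multiDerDeg n (2 * p + 1) k) =
      (k + n).choose n + ∑ r : Fin n, (k + n - ((n + 1) * p + r + 1)).choose n := by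
  refine finrank_multiDerDeg_of_integrands (q := p) hn k
    (fun r => (∏ j : Fin (n + 1), (X 0 - X j.succ)) ^ p * X 0 ^ (r : ℕ)) _
    (fun r => Polynomial.X ^ (r : ℕ))
    (fun r => ?_) (fun r => ?_) (fun r i j hij => ⟨p, p, by ring,
      (X_sub_C_mul_X_sub_C_pow_dvd_nodePoly_pow hij p).mul_right _⟩) (fun c y hy h => ?_) ?_
  · have h := (isHomogeneous_prod_X_sub_X n Finset.univ).pow p
    rw [Finset.card_univ, Fintype.card_fin] at h
    exact h.mul (isHomogeneous_X_pow 0 r)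
  · rw [map_mul, map_pow, map_pow, finSuccEquiv_prod_X_sub_X, finSuccEquiv_X_zero, nodePoly]
  · simp only [Polynomial.map_pow, Polynomial.map_X] at h
    set G : Polynomial ℝ := ∑ r : Fin n, Polynomial.C (c r) * Polynomial.X ^ (r : ℕ) with hG
    have hdeg : G.natDegree < Fintype.card (Fin n) := by
      rw [Fintype.card_fin]
      refine Nat.lt_of_le_pred hn (Polynomial.natDegree_sum_le_of_forall_le _ _ fun r _ => ?_)
      exact (Polynomial.natDegree_C_mul_X_pow_le _ _).trans (Nat.le_pred_of_lt r.2)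
    have hG0 := Polynomial.eq_zero_of_natDegree_lt_card_of_eval_eq_zero G
      (strictMono_of_mem_Ioo hy).injective h hdeg
    funext r
    have h1 := congrArg (fun P => Polynomial.coeff P r) hG0
    simpa [hG, Polynomial.finsetSum_coeff, Polynomial.coeff_X_pow, Fin.val_inj] using h1
  · have h := Finset.sum_range_id_mul_two n
    have h1 : ∑ r : Fin n, (r : ℕ) = ∑ i ∈ Finset.range n, i :=
      Fin.sum_univ_eq_sum_range (fun i => i) n
    obtain ⟨n, rfl⟩ := Nat.exists_eq_add_of_le' hn
    simp only [Finset.sum_add_distrib, Finset.sum_const, Finset.card_univ, Fintype.card_fin,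
      smul_eq_mul, add_mul, h1, h, Nat.add_sub_cancel]
    ring

theorem finrank_multiDerDeg_even {n : ℕ} (hn : 1 ≤ n) (p k : ℕ) :
    Module.finrank ℝ (multiDerDeg n (2 * (p + 1)) k) =
      (k + n).choose n + n * (k + n - (n + 1) * (p + 1)).choose n := by
  let s : Fin n → Finset (Fin (n + 1)) := fun r => Finset.univ.erase r.succ
  have hs : ∀ r, (s r).card = n := fun r => by simp [s]
  refine (finrank_multiDerDeg_of_integrands (q := p) hn k
    (fun r => (∏ j : Fin (n + 1), (X 0 - X j.succ)) ^ p * ∏ j ∈ s r, (X 0 - X j.succ))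
    (fun _ => (n + 1) * p + n)
    (fun r => ∏ j ∈ s r, (Polynomial.X - Polynomial.C (X j)))
    (fun r => ?_) (fun r => ?_) (fun r i j hij => ?_) (fun c y hy h => ?_) ?_).trans ?_
  · have h := (isHomogeneous_prod_X_sub_X n Finset.univ).pow p
    rw [Finset.card_univ, Fintype.card_fin] at h
    have h2 := isHomogeneous_prod_X_sub_X n (s r)
    rw [hs] at h2
    exact h.mul h2
  · rw [map_mul, map_pow, finSuccEquiv_prod_X_sub_X, finSuccEquiv_prod_X_sub_X, nodePoly]
  · have h1 := X_sub_C_mul_X_sub_C_pow_dvd_nodePoly_pow hij p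
    by_cases hr : r.succ = i
    · have hj : j ∈ s r := Finset.mem_erase.2 ⟨fun h => hij (hr.symm.trans h.symm), Finset.mem_univ _⟩
      refine ⟨p, p + 1, by ring, ?_⟩
      rw [pow_succ, ← mul_assoc]
      exact mul_dvd_mul h1 (Finset.dvd_prod_of_mem _ hj)
    · have hi : i ∈ s r := Finset.mem_erase.2 ⟨Ne.symm hr, Finset.mem_univ _⟩
      refine ⟨p + 1, p, by ring, ?_⟩
      rw [pow_succ, mul_right_comm]
      exact mul_dvd_mul h1 (Finset.dvd_prod_of_mem _ hi)
  · simp only [Polynomial.map_prod, Polynomial.map_sub, Polynomial.map_X, Polynomial.map_C,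
      evalNodes_X] at h
    set G : Polynomial ℝ := ∑ r : Fin n, Polynomial.C (c r) *
      ∏ j ∈ s r, (Polynomial.X - Polynomial.C ((j : ℕ) : ℝ)) with hG
    have hdeg : G.natDegree < Fintype.card (Fin (n + 1)) := by
      rw [Fintype.card_fin]
      refine Nat.lt_succ_of_le (Polynomial.natDegree_sum_le_of_forall_le _ _ fun r _ => ?_)
      refine (Polynomial.natDegree_C_mul_le _ _).trans ?_
      rw [Polynomial.natDegree_finsetProd_X_sub_C_eq_card, hs]
    have hroot : ∀ i : Fin (n + 1), G.eval ((Fin.cons 0 y : Fin (n + 1) → ℝ) i) = 0 := by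
      refine Fin.cases ?_ fun i => ?_
      · rw [hG, Polynomial.eval_finsetSum]
        refine Finset.sum_eq_zero fun r _ => ?_
        rw [Polynomial.eval_mul, Polynomial.eval_prod,
          Finset.prod_eq_zero (i := 0) (Finset.mem_erase.2 ⟨(Fin.succ_ne_zero r).symm,
            Finset.mem_univ _⟩) (by simp), mul_zero]
      · simpa using h i
    have hinj : Function.Injective (Fin.cons 0 y : Fin (n + 1) → ℝ) := by
      refine Fin.cons_injective_iff.2 ⟨?_, (strictMono_of_mem_Ioo hy).injective⟩
      rintro ⟨i, hi⟩
      have h1 := (hy i).1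
      rw [hi] at h1
      exact absurd h1 (not_lt.2 (Nat.cast_nonneg _))
    have hG0 := Polynomial.eq_zero_of_natDegree_lt_card_of_eval_eq_zero G hinj hroot hdeg
    funext r
    have h1 := congrArg (Polynomial.eval ((r.succ : ℕ) : ℝ)) hG0
    rw [hG, Polynomial.eval_finsetSum, Finset.sum_eq_single r] at h1
    · rw [Polynomial.eval_mul, Polynomial.eval_C, Polynomial.eval_zero] at h1
      refine (mul_eq_zero.1 h1).resolve_right ?_
      rw [Polynomial.eval_prod]
      refine Finset.prod_ne_zero_iff.2 fun j hj => ?_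
      rw [Polynomial.eval_sub, Polynomial.eval_X, Polynomial.eval_C, sub_ne_zero]
      exact fun e => Finset.ne_of_mem_erase hj (Fin.ext (Nat.cast_injective e)).symm
    · intro b _ hb
      rw [Polynomial.eval_mul, Polynomial.eval_prod,
        Finset.prod_eq_zero (i := r.succ) (Finset.mem_erase.2
          ⟨fun h => hb (Fin.succ_injective _ h).symm, Finset.mem_univ _⟩) (by simp), mul_zero]
    · exact fun h => absurd (Finset.mem_univ _) h
  · simp only [Finset.sum_const, Finset.card_univ, Fintype.card_fin, smul_eq_mul]
    ring
  · simp [mul_add, add_assoc]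

/-- The dimension of the degree-`k` homogeneous piece of the module `D^m(A_n)` of
`m`-multiderivations of the braid arrangement, for `m` even resp. odd (a consequence of
Terao's theorem; thanks to truncated subtraction, `binom(a, n) = 0` whenever the corresponding
integer is less than `n`). -/
theorem finrank_multiDerDeg (n m k : ℕ) (hn : 1 ≤ n) (hm : 1 ≤ m) :
    (Even m → Module.finrank ℝ (multiDerDeg n m k) =
      (k + n).choose n + n * ((k + n - m * (n + 1) / 2).choose n)) ∧
    (Odd m → Module.finrank ℝ (multiDerDeg n m k) =
      (k + n).choose n +
        ∑ i ∈ Finset.Icc 1 n, ((k + n - (m - 1) * (n + 1) / 2 - i).choose n)) := by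
  refine ⟨?_, ?_⟩
  · rintro ⟨p, rfl⟩
    obtain ⟨p, rfl⟩ := Nat.exists_eq_add_of_le' (show 1 ≤ p by omega)
    rw [show p + 1 + (p + 1) = 2 * (p + 1) by ring, finrank_multiDerDeg_even hn,
      show 2 * (p + 1) * (n + 1) = (n + 1) * (p + 1) * 2 by ring, Nat.mul_div_cancel _ two_pos]
  · rintro ⟨p, rfl⟩
    rw [finrank_multiDerDeg_odd hn, Nat.add_sub_cancel,
      show 2 * p * (n + 1) = (n + 1) * p * 2 by ring, Nat.mul_div_cancel _ two_pos,
      ← Finset.Ico_add_one_right_eq_Icc, Finset.sum_Ico_eq_sum_range, Nat.add_sub_cancel,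
      Fin.sum_univ_eq_sum_range (fun r => (k + n - ((n + 1) * p + r + 1)).choose n)]
    congr 1
    refine Finset.sum_congr rfl fun r _ => ?_
    rw [Nat.sub_sub, add_comm 1 r, ← add_assoc]

end
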